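/- arXiv:math/0608353 — 6 statements merged into one kernel-verified Lean document; each statement's English description precedes it below -/
import Mathlib

section
/- Let X be a compact metric space with a Borel measure μ such that μ({x}) = 0 for a given point x ∈ X, and let H = L²(X, μ). If K : ℝˢ → 𝒦(H) is a norm-continuous family of compact operators with ‖K(q)‖ → 0 as |q| → ∞, then the localized norms of K tend to zero at x: for every ε > 0 there exists δ > 0 such that ‖K(q) f‖ ≤ ε ‖f‖ for all q ∈ ℝˢ and all f ∈ H vanishing μ-a.e. outside the closed ball of radius δ about x. -/
open MeasureTheory Filter
open scoped ENNReal Topology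

/-- An `L²` function has small pairing with functions supported near a point of measure zero. -/
lemma exists_norm_inner_le_of_support_closedBall
    {X : Type*} [MetricSpace X] [MeasurableSpace X] [BorelSpace X]
    (μ : Measure X) (x : X) (hx : μ {x} = 0) (g : Lp ℂ 2 μ) {ε : ℝ} (hε : 0 < ε) :
    ∃ δ > (0 : ℝ), ∀ f : Lp ℂ 2 μ,
      (∀ᵐ y ∂μ, y ∉ Metric.closedBall x δ → f y = 0) → ‖inner ℂ f g‖ ≤ ε * ‖f‖ := by
  set ν : Measure X := μ.withDensity fun y => ‖g y‖ₑ ^ (2 : ℝ) with hν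
  have hfin : ∫⁻ y, ‖g y‖ₑ ^ (2 : ℝ) ∂μ < ∞ := by
    simpa using lintegral_rpow_enorm_lt_top_of_eLpNorm_lt_top two_ne_zero ENNReal.ofNat_ne_top
      (Lp.memLp g).eLpNorm_lt_top
  have : IsFiniteMeasure ν := isFiniteMeasure_withDensity hfin.ne
  have hνx : ν {x} = 0 := withDensity_absolutelyContinuous _ _ hx
  have hlim : Tendsto (fun r => ν (Metric.cthickening r {x})) (𝓝 0) (𝓝 0) := by
    simpa only [hνx] using tendsto_measure_cthickening_of_isClosed (μ := ν)
      ⟨1, one_pos, measure_ne_top _ _⟩ (isClosed_singleton (x := x))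
  have hε2 : 0 < ENNReal.ofReal ε ^ (2 : ℝ) := by
    apply ENNReal.rpow_pos <;> simp [hε]
  obtain ⟨δ, hδν, hδ⟩ := ((hlim.mono_left nhdsWithin_le_nhds).eventually_lt_const hε2
    |>.and (self_mem_nhdsWithin (s := Set.Ioi (0 : ℝ)))).exists
  refine ⟨δ, hδ, fun f hf => ?_⟩
  rw [Metric.cthickening_singleton _ (le_of_lt hδ),
    withDensity_apply _ Metric.isClosed_closedBall.measurableSet] at hδν
  have hmem : MemLp ((Metric.closedBall x δ).indicator g) 2 μ :=
    (Lp.memLp g).indicator Metric.isClosed_closedBall.measurableSet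
  have hnorm : ‖hmem.toLp‖ ≤ ε := by
    rw [Lp.norm_toLp]
    refine ENNReal.toReal_le_of_le_ofReal hε.le ?_
    rw [eLpNorm_indicator_eq_eLpNorm_restrict Metric.isClosed_closedBall.measurableSet,
      eLpNorm_eq_lintegral_rpow_enorm_toReal two_ne_zero ENNReal.ofNat_ne_top]
    rw [one_div, ENNReal.rpow_inv_le_iff (by simp)]
    simpa using hδν.le
  have hinner : inner ℂ f g = inner ℂ f hmem.toLp := by
    rw [L2.inner_def, L2.inner_def]
    refine integral_congr_ae ?_
    filter_upwards [hf, hmem.coeFn_toLp] with y hy hgy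
    rw [hgy]
    by_cases hyB : y ∈ Metric.closedBall x δ
    · rw [Set.indicator_of_mem hyB]
    · simp [hy hyB]
  rw [hinner, mul_comm]
  exact (norm_inner_le_norm _ _).trans (by gcongr)

/-- A compact operator has small norm on functions supported near a point of measure zero. -/
lemma IsCompactOperator.exists_norm_le_of_support_closedBall
    {X : Type*} [MetricSpace X] [MeasurableSpace X] [BorelSpace X]
    (μ : Measure X) (x : X) (hx : μ {x} = 0) {T : Lp ℂ 2 μ →L[ℂ] Lp ℂ 2 μ}
    (hT : IsCompactOperator T) {ε : ℝ} (hε : 0 < ε) :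
    ∃ δ > (0 : ℝ), ∀ f : Lp ℂ 2 μ,
      (∀ᵐ y ∂μ, y ∉ Metric.closedBall x δ → f y = 0) → ‖T f‖ ≤ ε * ‖f‖ := by
  by_contra! hcon
  have hunit : ∀ n : ℕ, ∃ f : Lp ℂ 2 μ, ‖f‖ = 1 ∧ ε ≤ ‖T f‖ ∧
      ∀ᵐ y ∂μ, y ∉ Metric.closedBall x (1 / ((n : ℝ) + 1)) → f y = 0 := by
    intro n
    obtain ⟨f, hf, hTf⟩ := hcon (1 / ((n : ℝ) + 1)) Nat.one_div_pos_of_nat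
    have hf0 : f ≠ 0 := by
      rintro rfl
      simp at hTf
    have hpos : 0 < ‖f‖ := norm_pos_iff.2 hf0
    refine ⟨((‖f‖⁻¹ : ℝ) : ℂ) • f, ?_, ?_, ?_⟩
    · rw [norm_smul, Complex.norm_real, norm_inv, norm_norm, inv_mul_cancel₀ hpos.ne']
    · rw [map_smul, norm_smul, Complex.norm_real, norm_inv, norm_norm, inv_mul_eq_div,
        le_div_iff₀ hpos]
      exact hTf.le
    · filter_upwards [hf, Lp.coeFn_smul (((‖f‖⁻¹ : ℝ) : ℂ)) f] with y hy hsm hyB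
      rw [hsm, Pi.smul_apply, hy hyB, smul_zero]
  choose f hf1 hfε hfsupp using hunit
  obtain ⟨z, -, φ, hφ, hz⟩ := (hT.isCompact_closure_image_closedBall 1).tendsto_subseq
    (x := fun n => T (f n)) fun n =>
      subset_closure ⟨f n, by simp [hf1], rfl⟩
  have hzε : ε ≤ ‖z‖ := ge_of_tendsto' hz.norm fun n => hfε _
  have hzpos : 0 < ‖z‖ := hε.trans_le hzε
  obtain ⟨δ, hδ, hinner⟩ := exists_norm_inner_le_of_support_closedBall μ x hx
    (ContinuousLinearMap.adjoint T z) (half_pos (pow_pos hzpos 2))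
  have hle : ‖inner ℂ z z‖ ≤ ‖z‖ ^ 2 / 2 := by
    refine le_of_tendsto (hz.inner (tendsto_const_nhds (x := z))).norm ?_
    have hsmall := (tendsto_one_div_add_atTop_nhds_zero_nat (𝕜 := ℝ)).comp hφ.tendsto_atTop
    filter_upwards [hsmall.eventually_lt_const hδ] with n hn
    have h := hinner (f (φ n)) <| (hfsupp (φ n)).mono fun y hy hyB =>
      hy fun hyn => hyB (Metric.closedBall_subset_closedBall hn.le hyn)
    rwa [ContinuousLinearMap.adjoint_inner_right, hf1, mul_one] at h
  rw [inner_self_eq_norm_sq_to_K] at hle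
  simp only [norm_pow, Complex.coe_algebraMap, Complex.norm_real, norm_norm] at hle
  nlinarith [pow_pos hzpos 2]

/-- If `μ {x} = 0` and `K : ℝˢ → 𝒦(L²(X, μ))` is a norm-continuous family of compact operators
whose norm tends to `0` at infinity, then the localized norms of `K` tend to zero at `x`:
for every `ε > 0` there is `δ > 0` such that `‖K(q) f‖ ≤ ε ‖f‖` for all `q ∈ ℝˢ` and all
`f ∈ L²` vanishing `μ`-a.e. outside the closed ball of radius `δ` about `x`. -/
theorem compact_family_localized_norm_tendsto_zero
    {X : Type} [MetricSpace X] [CompactSpace X] [MeasurableSpace X] [BorelSpace X]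
    (μ : Measure X) (x : X) (hx : μ {x} = 0) (s : ℕ)
    (K : EuclideanSpace ℝ (Fin s) → (Lp ℂ 2 μ →L[ℂ] Lp ℂ 2 μ))
    (hKcont : Continuous K)
    (hKcpt : ∀ q, IsCompactOperator (K q))
    (hKdecay : Tendsto (fun q => ‖K q‖) (cocompact (EuclideanSpace ℝ (Fin s))) (𝓝 0)) :
    ∀ ε > (0 : ℝ), ∃ δ > (0 : ℝ), ∀ q : EuclideanSpace ℝ (Fin s), ∀ f : Lp ℂ 2 μ,
      (∀ᵐ y ∂μ, y ∉ Metric.closedBall x δ → f y = 0) → ‖K q f‖ ≤ ε * ‖f‖ := by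
  intro ε hε
  have hfar : {q | ε < ‖K q‖}ᶜ ∈ cocompact (EuclideanSpace ℝ (Fin s)) := by
    filter_upwards [hKdecay.eventually_lt_const hε] with q hq using not_lt.2 (le_of_lt hq)
  obtain ⟨C, hC, hCsub⟩ := mem_cocompact.1 hfar
  have hnear : ∃ δ > (0 : ℝ), ∀ q ∈ C, ∀ f : Lp ℂ 2 μ,
      (∀ᵐ y ∂μ, y ∉ Metric.closedBall x δ → f y = 0) → ‖K q f‖ ≤ ε * ‖f‖ := by
    refine hC.induction_on (p := fun S => ∃ δ > (0 : ℝ), ∀ q ∈ S, ∀ f : Lp ℂ 2 μ,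
      (∀ᵐ y ∂μ, y ∉ Metric.closedBall x δ → f y = 0) → ‖K q f‖ ≤ ε * ‖f‖)
      ⟨1, one_pos, by simp⟩ ?_ ?_ ?_
    · rintro S S' hS ⟨δ, hδ, h⟩
      exact ⟨δ, hδ, fun q hq => h q (hS hq)⟩
    · rintro S S' ⟨δ, hδ, h⟩ ⟨δ', hδ', h'⟩
      refine ⟨min δ δ', lt_min hδ hδ', fun q hq f hf => ?_⟩
      rcases hq with hq | hq
      · exact h q hq f <| hf.mono fun y hy hyB => hy fun hyn =>
          hyB (Metric.closedBall_subset_closedBall (min_le_left _ _) hyn)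
      · exact h' q hq f <| hf.mono fun y hy hyB => hy fun hyn =>
          hyB (Metric.closedBall_subset_closedBall (min_le_right _ _) hyn)
    · intro q _
      obtain ⟨δ, hδ, h⟩ :=
        (hKcpt q).exists_norm_le_of_support_closedBall μ x hx (half_pos hε)
      refine ⟨K ⁻¹' Metric.ball (K q) (ε / 2), mem_nhdsWithin_of_mem_nhds
        (hKcont.continuousAt (Metric.ball_mem_nhds _ (half_pos hε))), δ, hδ,
        fun q' hq' f hf => ?_⟩
      have hdist : ‖K q' - K q‖ ≤ ε / 2 := (mem_ball_iff_norm.1 hq').le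
      calc ‖K q' f‖ = ‖(K q' - K q) f + K q f‖ := by simp
        _ ≤ ‖(K q' - K q) f‖ + ‖K q f‖ := norm_add_le _ _
        _ ≤ ε / 2 * ‖f‖ + ε / 2 * ‖f‖ :=
          add_le_add ((K q' - K q).le_of_opNorm_le hdist f) (h f hf)
        _ = ε * ‖f‖ := by ring
  obtain ⟨δ, hδ, h⟩ := hnear
  refine ⟨δ, hδ, fun q f hf => ?_⟩
  by_cases hq : q ∈ C
  · exact h q hq f hf
  · exact (K q).le_of_opNorm_le (not_lt.1 (hCsub hq)) f
end

section
/- Let H be a complex Hilbert space and s ∈ ℕ. The set 𝒜_scv of functions of slow compact variation — i.e., bounded norm-continuous maps A : ℝˢ → B(H) such that (1) A(q) − A(q′) is a compact operator for all q, q′ ∈ ℝˢ, and (2) for all d > 0 and ε > 0 there exists R > 0 such that ‖A(y) − A(y′)‖ ≤ ε whenever |y − y′| < d and |y| > R — is a C*-subalgebra of the C*-algebra of bounded continuous B(H)-valued functions on ℝˢ: it is closed under addition, multiplication, scalar multiplication, and adjoints, and is closed in the supremum norm. -/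
open Filter
open scoped Topology

noncomputable section

/-- The set `𝒜_scv` of functions of slow compact variation: bounded norm-continuous maps
`A : ℝˢ → B(H)` such that `A(q) − A(q')` is compact for all `q, q'` and `A` slowly varies at
infinity. -/
def Ascv (s : ℕ) (H : Type) [NormedAddCommGroup H] [InnerProductSpace ℂ H] [CompleteSpace H] :
    Set (BoundedContinuousFunction (EuclideanSpace ℝ (Fin s)) (H →L[ℂ] H)) :=
  {A | (∀ q q', IsCompactOperator ((A q - A q' : H →L[ℂ] H) : H → H)) ∧
    ∀ d > (0 : ℝ), ∀ ε > (0 : ℝ), ∃ R > (0 : ℝ), ∀ y y' : EuclideanSpace ℝ (Fin s),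
      ‖y - y'‖ < d → R < ‖y‖ → ‖A y - A y'‖ ≤ ε}

/-- The adjoint of a compact operator between Hilbert spaces is compact. -/
theorem IsCompactOperator.adjoint {𝕜 E F : Type*} [RCLike 𝕜]
    [NormedAddCommGroup E] [InnerProductSpace 𝕜 E] [CompleteSpace E]
    [NormedAddCommGroup F] [InnerProductSpace 𝕜 F] [CompleteSpace F]
    {K : E →L[𝕜] F} (hK : IsCompactOperator K) :
    IsCompactOperator (ContinuousLinearMap.adjoint K) := by
  set L : F →L[𝕜] E := ContinuousLinearMap.adjoint K
  have hnorm (x : F) : ‖L x‖ ^ 2 ≤ ‖x‖ * ‖K (L x)‖ := by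
    have h : ‖L x‖ ^ 2 = RCLike.re (inner 𝕜 x (K (L x))) := by
      rw [← ContinuousLinearMap.adjoint_inner_left, inner_self_eq_norm_sq]
    exact h ▸ re_inner_le_norm x _
  have hKL : TotallyBounded ((fun x => K (L x)) '' Metric.ball 0 1) := by
    have h : IsCompactOperator (K.comp L) := hK.comp_clm L
    exact (IsCompactOperator.isCompact_closure_image_ball
      (f := (K.comp L : F →ₗ[𝕜] F)) h 1).totallyBounded.subset
      subset_closure
  refine (isCompactOperator_iff_isCompact_closure_image_ball (L : F →ₗ[𝕜] E) one_pos).2 ?_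
  refine (TotallyBounded.closure ?_).isCompact_of_isClosed isClosed_closure
  refine Metric.totallyBounded_iff.2 fun ε hε => ?_
  obtain ⟨t, hts, htf, ht⟩ := totallyBounded_iff_subset.1 hKL _
    (Metric.dist_mem_uniformity (show 0 < ε ^ 2 / 2 by positivity))
  obtain ⟨u, hu, huf, rfl⟩ := Set.exists_subset_image_finite_and.1 ⟨t, hts, htf, rfl⟩
  refine ⟨L '' u, huf.image _, ?_⟩
  rintro _ ⟨x, hx, rfl⟩
  obtain ⟨_, ⟨y, hy, rfl⟩, hxy⟩ := Set.mem_iUnion₂.1 (ht ⟨x, hx, rfl⟩)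
  refine Set.mem_iUnion₂.2 ⟨L y, ⟨y, hy, rfl⟩, ?_⟩
  have hxn : ‖x‖ < 1 := by simpa using hx
  have hyn : ‖y‖ < 1 := by simpa using hu hy
  have hxy' : ‖K (L (x - y))‖ < ε ^ 2 / 2 := by
    simpa [dist_eq_norm] using hxy
  have hsub : ‖x - y‖ ≤ 2 := (norm_sub_le x y).trans (by linarith)
  have hsq : ‖L (x - y)‖ ^ 2 < ε ^ 2 := calc
    _ ≤ ‖x - y‖ * ‖K (L (x - y))‖ := hnorm _
    _ ≤ 2 * ‖K (L (x - y))‖ := by gcongr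
    _ < ε ^ 2 := by linarith
  simpa [dist_eq_norm] using lt_of_pow_lt_pow_left₀ 2 hε.le hsq

/-- `𝒜_scv` is a C*-subalgebra of the C*-algebra of bounded continuous `B(H)`-valued
functions on `ℝˢ`: it is closed under addition, multiplication, scalar multiplication and
adjoints, and is closed in the supremum norm. -/
theorem Ascv_isCStarSubalgebra (s : ℕ) (H : Type)
    [NormedAddCommGroup H] [InnerProductSpace ℂ H] [CompleteSpace H] :
    (∀ A ∈ Ascv s H, ∀ B ∈ Ascv s H, A + B ∈ Ascv s H) ∧
    (∀ A ∈ Ascv s H, ∀ B ∈ Ascv s H, A * B ∈ Ascv s H) ∧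
    (∀ (c : ℂ), ∀ A ∈ Ascv s H, c • A ∈ Ascv s H) ∧
    (∀ A ∈ Ascv s H, star A ∈ Ascv s H) ∧
    IsClosed (Ascv s H) := by
  refine ⟨?_, ?_, ?_, ?_, ?_⟩
  · rintro A ⟨hA, hA'⟩ B ⟨hB, hB'⟩
    refine ⟨fun q q' => ?_, fun d hd ε hε => ?_⟩
    · have h : (A + B) q - (A + B) q' = (A q - A q') + (B q - B q') := by
        simp only [BoundedContinuousFunction.add_apply]; abel
      rw [h]
      exact (hA q q').add (hB q q')
    · obtain ⟨R, hR, h⟩ := hA' d hd (ε / 2) (by positivity)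
      obtain ⟨S, -, h'⟩ := hB' d hd (ε / 2) (by positivity)
      refine ⟨max R S, lt_max_of_lt_left hR, fun y y' hy hRy => ?_⟩
      calc ‖(A + B) y - (A + B) y'‖ = ‖(A y - A y') + (B y - B y')‖ := by
            simp only [BoundedContinuousFunction.add_apply]; congr 1; abel
        _ ≤ ε / 2 + ε / 2 := norm_add_le_of_le (h y y' hy ((le_max_left _ _).trans_lt hRy))
            (h' y y' hy ((le_max_right _ _).trans_lt hRy))
        _ = ε := add_halves ε
  · rintro A ⟨hA, hA'⟩ B ⟨hB, hB'⟩
    have hAB (q q') : (A * B) q - (A * B) q' = A q * (B q - B q') + (A q - A q') * B q' := by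
      simp only [BoundedContinuousFunction.mul_apply]; noncomm_ring
    refine ⟨fun q q' => ?_, fun d hd ε hε => ?_⟩
    · rw [hAB]
      exact ((hB q q').clm_comp (A q)).add ((hA q q').comp_clm (B q'))
    · have hM : 0 < ‖A‖ + ‖B‖ + 1 := by positivity
      set δ := ε / (‖A‖ + ‖B‖ + 1)
      have hδ0 : 0 < δ := by positivity
      obtain ⟨R, hR, h⟩ := hA' d hd δ hδ0
      obtain ⟨S, -, h'⟩ := hB' d hd δ hδ0
      refine ⟨max R S, lt_max_of_lt_left hR, fun y y' hy hRy => ?_⟩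
      have h₁ := h y y' hy ((le_max_left _ _).trans_lt hRy)
      have h₂ := h' y y' hy ((le_max_right _ _).trans_lt hRy)
      calc ‖(A * B) y - (A * B) y'‖ ≤ ‖A y‖ * ‖B y - B y'‖ + ‖A y - A y'‖ * ‖B y'‖ := by
            rw [hAB]
            exact norm_add_le_of_le (norm_mul_le _ _) (norm_mul_le _ _)
        _ ≤ ‖A‖ * δ + δ * ‖B‖ := by
            gcongr
            · exact A.norm_coe_le_norm y
            · exact B.norm_coe_le_norm y'
        _ ≤ δ * (‖A‖ + ‖B‖ + 1) := by linarith
        _ = ε := div_mul_cancel₀ _ hM.ne'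
  · rintro c A ⟨hA, hA'⟩
    have hcA (q q') : (c • A) q - (c • A) q' = c • (A q - A q') := by
      simp only [BoundedContinuousFunction.smul_apply, smul_sub]
    refine ⟨fun q q' => ?_, fun d hd ε hε => ?_⟩
    · rw [hcA]
      exact (hA q q').smul c
    · have hM : 0 < ‖c‖ + 1 := by positivity
      obtain ⟨R, hR, h⟩ := hA' d hd (ε / (‖c‖ + 1)) (by positivity)
      refine ⟨R, hR, fun y y' hy hRy => ?_⟩
      calc ‖(c • A) y - (c • A) y'‖ = ‖c‖ * ‖A y - A y'‖ := by rw [hcA, norm_smul]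
        _ ≤ (‖c‖ + 1) * (ε / (‖c‖ + 1)) := by
            gcongr
            · linarith
            · exact h y y' hy hRy
        _ = ε := mul_div_cancel₀ _ hM.ne'
  · rintro A ⟨hA, hA'⟩
    have hstar (q q') : (star A) q - (star A) q' = star (A q - A q') := by
      simp only [BoundedContinuousFunction.star_apply, star_sub]
    refine ⟨fun q q' => ?_, fun d hd ε hε => ?_⟩
    · rw [hstar]
      exact (hA q q').adjoint
    · obtain ⟨R, hR, h⟩ := hA' d hd ε hε
      refine ⟨R, hR, fun y y' hy hRy => ?_⟩
      rw [hstar, norm_star]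
      exact h y y' hy hRy
  · rw [Ascv, Set.ofPred_and]
    refine IsClosed.inter ?_ ?_
    · simp only [Set.ofPred_forall]
      refine isClosed_iInter fun q => isClosed_iInter fun q' => ?_
      exact (isClosed_setOfPred_isCompactOperator (σ₁₂ := RingHom.id ℂ)).preimage
        ((continuous_eval_const q).sub (continuous_eval_const q'))
    · refine isClosed_of_closure_subset fun A hA d hd ε hε => ?_
      obtain ⟨B, hB, hAB⟩ := Metric.mem_closure_iff.1 hA (ε / 3) (by positivity)
      obtain ⟨R, hR, h⟩ := hB d hd (ε / 3) (by positivity)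
      refine ⟨R, hR, fun y y' hy hRy => ?_⟩
      rw [← dist_eq_norm]
      have h₁ := BoundedContinuousFunction.dist_coe_le_dist (f := A) (g := B) y
      have h₂ := BoundedContinuousFunction.dist_coe_le_dist (f := A) (g := B) y'
      have h₃ := h y y' hy hRy
      rw [← dist_eq_norm] at h₃
      rw [dist_comm] at h₂
      linarith [dist_triangle4 (A y) (B y) (B y') (A y')]
end
end

section
/- Let H be a complex Hilbert space and s ∈ ℕ, and let A : ℝˢ → B(H) be a function of slow compact variation. Then for every ε > 0 there exists an infinitely differentiable (C^∞ in the operator norm) map B : ℝˢ → B(H) such that (1) B(q) − B(q′) is compact for all q, q′ ∈ ℝˢ; (2) every Fréchet derivative of B of order ≥ 1 tends to 0 in norm as |q| → ∞; and (3) sup_{q∈ℝˢ} ‖A(q) − B(q)‖ ≤ ε. -/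
open MeasureTheory Metric Function ContinuousLinearMap
open scoped Convolution

section Convolution

universe u

/-- The derivatives of a convolution with a fixed compactly supported smooth kernel are controlled
by the size of the other factor on a ball containing the relevant translate of the support. -/
theorem exists_norm_iteratedFDeriv_convolution_le {G E : Type u} [NormedAddCommGroup G]
    [NormedSpace ℝ G] [FiniteDimensional ℝ G] [MeasurableSpace G] [BorelSpace G] (μ : Measure G)
    [μ.IsAddHaarMeasure] [NormedAddCommGroup E] [NormedSpace ℝ E] (n : ℕ) :
    ∀ {E' F : Type u} [NormedAddCommGroup E'] [NormedSpace ℝ E'] [NormedAddCommGroup F]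
      [NormedSpace ℝ F] (L : E' →L[ℝ] E →L[ℝ] F) {f : G → E'},
      ContDiff ℝ (⊤ : ℕ∞) f → HasCompactSupport f → ∀ {r : ℝ}, tsupport f ⊆ ball 0 r →
      ∃ C : ℝ, 0 ≤ C ∧ ∀ g : G → E, Continuous g → ∀ (x : G) (M : ℝ), 0 ≤ M →
        (∀ y ∈ ball x r, ‖g y‖ ≤ M) → ‖iteratedFDeriv ℝ n (f ⋆[L, μ] g) x‖ ≤ C * M := by
  induction n with
  | zero =>
    intro E' F _ _ _ _ L f hf hcf r hr
    refine ⟨‖L‖ * ∫ x, ‖f x‖ ∂μ, by positivity, fun g hg x M hM hgM => ?_⟩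
    have := dist_convolution_le' (L := L) (z₀ := 0) hM
      (hf.continuous.integrable_of_hasCompactSupport hcf (μ := μ)) ((subset_tsupport f).trans hr)
      hg.aestronglyMeasurable (x₀ := x) (by simpa using hgM)
    simpa using this
  | succ n ih =>
    intro E' F _ _ _ _ L f hf hcf r hr
    obtain ⟨C, hC, h⟩ := ih (L.precompL G) (hf.fderiv_right (m := (⊤ : ℕ∞)) le_rfl)
      (hcf.fderiv ℝ) ((tsupport_fderiv_subset ℝ).trans hr)
    refine ⟨C, hC, fun g hg x M hM hgM => ?_⟩
    have hd : fderiv ℝ (f ⋆[L, μ] g) = fderiv ℝ f ⋆[L.precompL G, μ] g := funext fun y =>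
      (hcf.hasFDerivAt_convolution_left L (hf.of_le (by simp)) hg.locallyIntegrable y).fderiv
    rw [← norm_iteratedFDeriv_fderiv, hd]
    exact h g hg x M hM hgM

/-- Subtracting a constant from the second factor of a convolution only changes the convolution by
a constant. -/
theorem convolution_sub_const {G E E' F : Type*} [NormedAddCommGroup G] [MeasurableSpace G]
    [BorelSpace G] {μ : Measure G} [IsFiniteMeasureOnCompacts μ]
    [NormedAddCommGroup E] [NormedSpace ℝ E] [NormedAddCommGroup E'] [NormedSpace ℝ E']
    [NormedAddCommGroup F] [NormedSpace ℝ F] (L : E' →L[ℝ] E →L[ℝ] F) {f : G → E'}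
    (hf : Continuous f) (hcf : HasCompactSupport f) {g : G → E} (hg : Continuous g) (c : E) (x : G) :
    (f ⋆[L, μ] fun y => g y - c) x = (f ⋆[L, μ] g) x - ∫ t, L (f t) c ∂μ := by
  have key : ∀ k : G → E, Continuous k → Integrable (fun t => L (f t) (k (x - t))) μ := fun k hk =>
    (show Continuous fun t => L (f t) (k (x - t)) by fun_prop).integrable_of_hasCompactSupport
      (hcf.mono fun t => mt fun ht : f t = 0 => by simp [ht])
  simp only [convolution_def, map_sub]
  exact integral_sub (key g hg) (key (fun _ => c) continuous_const)

/-- A convolution with a compactly supported continuous scalar function takes values in every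
closed subspace containing the values of the second factor. -/
theorem convolution_lsmul_mem {G E : Type*} [NormedAddCommGroup G] [MeasurableSpace G]
    [NormedAddCommGroup E] [NormedSpace ℝ E] [CompleteSpace E]
    {μ : Measure G} {f : G → ℝ} {g : G → E} (S : Submodule ℝ E) (hS : IsClosed (S : Set E))
    (hgS : ∀ y, g y ∈ S) (x : G) : (f ⋆[lsmul ℝ ℝ, μ] g) x ∈ S := by
  have : CompleteSpace S := hS.completeSpace_coe
  have h := S.subtypeₗᵢ.integral_comp_comm (μ := μ) fun t => f t • (⟨g (x - t), hgS _⟩ : S)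
  have h' : (f ⋆[lsmul ℝ ℝ, μ] g) x = S.subtypeₗᵢ (∫ t, f t • (⟨g (x - t), hgS _⟩ : S) ∂μ) := h
  rw [h']
  exact Subtype.property _

end Convolution

/-- A continuous function on a proper space whose variation on the unit scale is at most `ε`
outside a ball varies by at most `ε` on some scale `δ > 0` everywhere. -/
theorem exists_forall_dist_le_of_slow_variation {X E : Type*} [NormedAddCommGroup X] [ProperSpace X]
    [NormedAddCommGroup E] {f : X → E} (hf : Continuous f) {ε R : ℝ} (hε : 0 < ε)
    (hR : ∀ y y' : X, ‖y - y'‖ < 1 → R < ‖y‖ → ‖f y - f y'‖ ≤ ε) :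
    ∃ δ > 0, ∀ x y, dist y x < δ → dist (f y) (f x) ≤ ε := by
  obtain ⟨δ, hδ, h⟩ := Metric.uniformContinuousOn_iff.1
    ((isCompact_closedBall (0 : X) (R + 1)).uniformContinuousOn_of_continuous hf.continuousOn) ε hε
  refine ⟨min δ 1, by positivity, fun x y hxy => ?_⟩
  rw [lt_min_iff] at hxy
  have htri : ‖y‖ ≤ ‖x‖ + dist y x := by
    rw [dist_eq_norm]
    exact norm_le_norm_add_norm_sub' y x
  rcases lt_or_ge R ‖x‖ with hx | hx
  · rw [dist_comm, dist_eq_norm]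
    exact hR x y (by rw [← dist_eq_norm, dist_comm]; exact hxy.2) hx
  · exact (h y (by simp; linarith) x (by simp; linarith) hxy.1).le


open Filter
open scoped Topology

/-- A function of slow compact variation `A : ℝˢ → B(H)` can be approximated, uniformly within
any `ε > 0`, by a `C^∞` map `B : ℝˢ → B(H)` of compact variation all of whose derivatives of
order `≥ 1` decay in norm at infinity. -/
theorem slow_compact_variation_smooth_approximation
    (s : ℕ) (H : Type) [NormedAddCommGroup H] [InnerProductSpace ℂ H] [CompleteSpace H]
    (A : EuclideanSpace ℝ (Fin s) → (H →L[ℂ] H))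
    (hAbdd : ∃ C : ℝ, ∀ q, ‖A q‖ ≤ C)
    (hAcont : Continuous A)
    (hAcv : ∀ q q', IsCompactOperator ((A q - A q' : H →L[ℂ] H) : H → H))
    (hAsv : ∀ d > (0 : ℝ), ∀ ε > (0 : ℝ), ∃ R > (0 : ℝ), ∀ y y' : EuclideanSpace ℝ (Fin s),
      ‖y - y'‖ < d → R < ‖y‖ → ‖A y - A y'‖ ≤ ε)
    (ε : ℝ) (hε : 0 < ε) :
    ∃ B : EuclideanSpace ℝ (Fin s) → (H →L[ℂ] H),
      ContDiff ℝ (⊤ : ℕ∞) B ∧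
      (∀ q q', IsCompactOperator ((B q - B q' : H →L[ℂ] H) : H → H)) ∧
      (∀ n : ℕ, 1 ≤ n → Tendsto (fun q => ‖iteratedFDeriv ℝ n B q‖)
        (cocompact (EuclideanSpace ℝ (Fin s))) (𝓝 0)) ∧
      (∀ q, ‖A q - B q‖ ≤ ε) := by
  obtain ⟨R, -, hR⟩ := hAsv 1 one_pos ε hε
  obtain ⟨δ, hδ, hAδ⟩ := exists_forall_dist_le_of_slow_variation hAcont hε hR
  let φ : ContDiffBump (0 : EuclideanSpace ℝ (Fin s)) := ⟨δ / 2, δ, by positivity, by linarith⟩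
  let f := φ.normed volume
  have hf : ContDiff ℝ (⊤ : ℕ∞) f := φ.contDiff_normed
  have hcf : HasCompactSupport f := φ.hasCompactSupport_normed
  let L : ℝ →L[ℝ] (H →L[ℂ] H) →L[ℝ] (H →L[ℂ] H) := lsmul ℝ ℝ
  have hsub : ∀ c q, (f ⋆[L, volume] A) q = (f ⋆[L, volume] fun y => A y - c) q + ∫ t, L (f t) c :=
    fun c q => by rw [convolution_sub_const L hf.continuous hcf hAcont c q, sub_add_cancel]
  refine ⟨f ⋆[L, volume] A, hcf.contDiff_convolution_left L hf hAcont.locallyIntegrable,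
    fun q q' => ?_, fun n hn => ?_, fun q => ?_⟩
  · have hmem := convolution_lsmul_mem (μ := volume) (f := f) (g := fun y => A y - A 0)
      ((compactOperator (RingHom.id ℂ) H H).restrictScalars ℝ)
      isClosed_setOfPred_isCompactOperator (fun y => hAcv y 0)
    have := Submodule.sub_mem _ (hmem q) (hmem q')
    rw [hsub (A 0) q, hsub (A 0) q', add_sub_add_right_eq_sub]
    exact this
  · obtain ⟨m, rfl⟩ := Nat.exists_eq_add_of_le' hn
    obtain ⟨C, hC, hbound⟩ := exists_norm_iteratedFDeriv_convolution_le volume (m + 1) L hf hcf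
      (r := δ + 1) (by
        rw [φ.tsupport_normed_eq]; exact closedBall_subset_ball (by simp [φ]))
    rw [← tendsto_zero_iff_norm_tendsto_zero, Metric.tendsto_nhds]
    intro η hη
    obtain ⟨R', -, hR'⟩ := hAsv (δ + 1) (by positivity) (η / (2 * (C + 1))) (by positivity)
    filter_upwards [tendsto_norm_cocompact_atTop.eventually_gt_atTop R'] with q hq
    have hle := hbound (fun y => A y - A q) (by fun_prop) q (η / (2 * (C + 1))) (by positivity)
      fun y hy => by
        rw [norm_sub_rev]
        exact hR' q y (by rwa [← dist_eq_norm, dist_comm]) hq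
    have hd : fderiv ℝ (f ⋆[L, volume] A) = fderiv ℝ (f ⋆[L, volume] fun y => A y - A q) := by
      rw [funext (hsub (A q))]
      exact funext fun y => fderiv_add_const _
    rw [dist_zero_right, ← norm_iteratedFDeriv_fderiv, hd, norm_iteratedFDeriv_fderiv]
    refine hle.trans_lt ?_
    rw [mul_div_assoc', div_lt_iff₀ (by positivity)]
    nlinarith
  · rw [← dist_eq_norm, dist_comm]
    exact φ.dist_normed_convolution_le hAcont.aestronglyMeasurable fun x hx => hAδ q x hx
end

section
/- Let G be a finite group, H a complex Hilbert space, S : G → B(H) a representation of G by bounded invertible operators on H, and σ : G → GL(ℝˢ) a faithful (injective) linear representation, s ≥ 1. For g ∈ G define T_g on the Bochner space L²(ℝˢ; H) by (T_g f)(p) = S_g(f(σ_g⁻¹ p)); call f invariant if T_g f = f in L² for all g ∈ G. Let A : ℝˢ → B(H) be a norm-continuous operator-valued function. If for every invariant f ∈ L²(ℝˢ; H) one has A(p)(f(p)) = 0 for almost every p ∈ ℝˢ, then A(p) = 0 for all p ∈ ℝˢ. -/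
open MeasureTheory Filter
open scoped Topology ENNReal

/-- The symmetrization `p ↦ ∑ g, S g (φ (σ g⁻¹ p))` of the function `φ = 1_B v`. -/
noncomputable def symmetrizedIndicator {E H G : Type*} [NormedAddCommGroup E] [NormedSpace ℝ E]
    [NormedAddCommGroup H] [NormedSpace ℂ H] [Group G] [Fintype G]
    (S : G →* (H →L[ℂ] H)ˣ) (σ : G →* (E ≃L[ℝ] E)) (B : Set E) (v : H) (p : E) : H :=
  ∑ g, (σ g⁻¹ ⁻¹' B).indicator (fun _ => (S g : H →L[ℂ] H) v) p

section

variable {E H G : Type*} [NormedAddCommGroup E] [NormedSpace ℝ E]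
  [NormedAddCommGroup H] [NormedSpace ℂ H] [Group G]

theorem symmetrizedIndicator_invariant [Fintype G] (S : G →* (H →L[ℂ] H)ˣ)
    (σ : G →* (E ≃L[ℝ] E)) (B : Set E) (v : H) (g : G) (p : E) :
    (S g : H →L[ℂ] H) (symmetrizedIndicator S σ B v ((σ g)⁻¹ p)) =
      symmetrizedIndicator S σ B v p := by
  classical
  unfold symmetrizedIndicator
  rw [map_sum]
  refine Fintype.sum_equiv (Equiv.mulLeft g) _ _ fun k => ?_
  have hmem : σ (g * k)⁻¹ p = σ k⁻¹ ((σ g)⁻¹ p) := by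
    rw [mul_inv_rev, map_mul, map_inv σ g]; rfl
  simp only [Equiv.coe_mulLeft, Set.indicator_apply, Set.mem_preimage, hmem]
  split_ifs <;> simp

theorem symmetrizedIndicator_eq_of_mem [Fintype G] (S : G →* (H →L[ℂ] H)ˣ)
    (σ : G →* (E ≃L[ℝ] E)) {B : Set E} (hB : ∀ g ≠ 1, ∀ p ∈ B, σ g p ∉ B) (v : H)
    {p : E} (hp : p ∈ B) : symmetrizedIndicator S σ B v p = v := by
  classical
  unfold symmetrizedIndicator
  rw [Fintype.sum_eq_single 1]
  · rw [Set.indicator_of_mem]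
    · simp
    · rw [inv_one, map_one]
      exact hp
  · intro g hg
    rw [Set.indicator_of_notMem]
    exact hB g⁻¹ (inv_ne_one.mpr hg) p hp

theorem memLp_symmetrizedIndicator [Fintype G] [MeasurableSpace E] [BorelSpace E] [ProperSpace E]
    (μ : Measure E) [IsFiniteMeasureOnCompacts μ] (S : G →* (H →L[ℂ] H)ˣ)
    (σ : G →* (E ≃L[ℝ] E)) {B : Set E} (hB : MeasurableSet B) (hb : Bornology.IsBounded B)
    (v : H) (q : ℝ≥0∞) : MemLp (symmetrizedIndicator S σ B v) q μ := by
  refine memLp_finsetSum _ fun g _ => memLp_indicator_const q ?_ _ (Or.inr ?_)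
  · exact (σ g⁻¹).continuous.measurable hB
  · rw [← (σ g⁻¹).image_symm_eq_preimage]
    exact ((σ g⁻¹).symm.lipschitz.isBounded_image hb).measure_lt_top.ne

theorem exists_ball_disjoint_translates [Finite G] (σ : G →* (E ≃L[ℝ] E)) {x : E}
    (hx : ∀ g ≠ 1, σ g x ≠ x) :
    ∃ r > 0, ∀ g ≠ 1, ∀ p ∈ Metric.ball x r, σ g p ∉ Metric.ball x r := by
  have h : ∀ᶠ z : E × E in 𝓝 (x, x), ∀ g : G, g ≠ 1 → σ g z.1 ≠ z.2 := by
    refine eventually_all.mpr fun g => ?_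
    by_cases hg : g = 1
    · simp [hg]
    · have hc : Continuous fun z : E × E => σ g z.1 := (σ g).continuous.comp continuous_fst
      filter_upwards [(isOpen_ne_fun hc continuous_snd).mem_nhds (hx g hg)] with z hz _
      exact hz
  obtain ⟨r, hr, h⟩ := Metric.eventually_nhds_iff_ball.mp h
  refine ⟨r, hr, fun g hg p hp hgp => h (p, σ g p) ?_ g hg rfl⟩
  rw [← ball_prod_same]
  exact ⟨hp, hgp⟩

theorem ae_forall_apply_ne [Finite G] [MeasurableSpace E] [BorelSpace E] [FiniteDimensional ℝ E]
    (μ : Measure E) [μ.IsAddHaarMeasure] (σ : G →* (E ≃L[ℝ] E)) (hσ : Function.Injective σ) :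
    ∀ᵐ p ∂μ, ∀ g ≠ 1, σ g p ≠ p := by
  refine ae_all_iff.mpr fun g => ?_
  by_cases hg : g = 1
  · simp [hg]
  let F : Submodule ℝ E := LinearMap.eqLocus (σ g : E →ₗ[ℝ] E) LinearMap.id
  have hF : F ≠ ⊤ := by
    intro h
    refine hg (hσ ?_)
    rw [map_one]
    ext p
    exact (h ▸ Submodule.mem_top : p ∈ F)
  filter_upwards [measure_eq_zero_iff_ae_notMem.mp (Measure.addHaar_submodule μ F hF)] with p hp _
  exact hp

theorem quasiMeasurePreserving_continuousLinearEquiv [MeasurableSpace E] [BorelSpace E]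
    [FiniteDimensional ℝ E] (μ : Measure E) [μ.IsAddHaarMeasure] (e : E ≃L[ℝ] E) :
    Measure.QuasiMeasurePreserving e μ μ :=
  Measure.LinearMap.quasiMeasurePreserving μ (e : E →ₗ[ℝ] E) e.toLinearEquiv.isUnit_det'.ne_zero

end


/-- If a norm-continuous operator-valued function `A : ℝˢ → B(H)` annihilates, pointwise almost
everywhere, every `G`-invariant element of `L²(ℝˢ; H)` (for the action
`(T_g f)(p) = S_g (f(σ_g⁻¹ p))` built from a representation `S` of the finite group `G` on `H`
and a faithful linear representation `σ` of `G` on `ℝˢ`), then `A(p) = 0` for all `p`. -/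
theorem annihilates_invariants_implies_zero
    {H : Type} [NormedAddCommGroup H] [InnerProductSpace ℂ H] [CompleteSpace H]
    {G : Type} [Group G] [Finite G] (s : ℕ) (hs : 1 ≤ s)
    (S : G →* (H →L[ℂ] H)ˣ)
    (σ : G →* (EuclideanSpace ℝ (Fin s) ≃L[ℝ] EuclideanSpace ℝ (Fin s)))
    (hσ : Function.Injective σ)
    (A : EuclideanSpace ℝ (Fin s) → (H →L[ℂ] H)) (hAcont : Continuous A)
    (hA : ∀ f : Lp H 2 (volume : Measure (EuclideanSpace ℝ (Fin s))),
      (∀ g : G, (fun p => (S g : H →L[ℂ] H) (f ((σ g)⁻¹ p))) =ᵐ[volume] ⇑f) →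
      ∀ᵐ p ∂(volume : Measure (EuclideanSpace ℝ (Fin s))), A p (f p) = 0) :
    ∀ p, A p = 0 := by
  classical
  have := Fintype.ofFinite G
  have hzero : ∀ x, (∀ g ≠ 1, σ g x ≠ x) → A x = 0 := by
    intro x hx
    obtain ⟨r, hr, hB⟩ := exists_ball_disjoint_translates σ hx
    ext v
    have hmem := memLp_symmetrizedIndicator volume S σ measurableSet_ball
      (Metric.isBounded_ball (x := x) (r := r)) v 2
    have hcoe := hmem.coeFn_toLp
    have hann := hA (hmem.toLp _) fun g => by
      have hq := quasiMeasurePreserving_continuousLinearEquiv volume (σ g)⁻¹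
      filter_upwards [hcoe, hq.ae hcoe] with p hp hgp
      rw [hp, hgp, symmetrizedIndicator_invariant]
    have hae : (fun p => A p v) =ᵐ[volume.restrict (Metric.ball x r)] fun _ => 0 := by
      refine (ae_restrict_iff' measurableSet_ball).mpr ?_
      filter_upwards [hann, hcoe] with p hp hcp hpB
      rwa [hcp, symmetrizedIndicator_eq_of_mem S σ hB v hpB] at hp
    exact Measure.eqOn_open_of_ae_eq hae Metric.isOpen_ball
      (hAcont.clm_apply continuous_const).continuousOn continuousOn_const
      (Metric.mem_ball_self hr)
  have hA0 : A =ᵐ[volume] fun _ => 0 := by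
    filter_upwards [ae_forall_apply_ne volume σ hσ] with p hp
    exact hzero p hp
  exact congrFun ((hAcont.ae_eq_iff_eq volume continuous_const).mp hA0)
end

section
/- Let A be an invertible d × d real matrix (equivalently, an invertible linear map of ℝᵈ) that maps the closed nonnegative orthant Q = [0,∞)ᵈ onto itself, A(Q) = Q. Then A factors as a permutation matrix times a positive diagonal matrix: there exist a permutation π of {1, …, d} and positive real numbers λ₁, …, λ_d such that A e_i = λ_i e_{π(i)} for each standard basis vector e_i of ℝᵈ. -/
/-- The closed nonnegative orthant `Q = [0,∞)ᵈ ⊆ ℝᵈ`. -/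
def orthant (d : ℕ) : Set (Fin d → ℝ) := {x | ∀ i, 0 ≤ x i}

/-- A linear injection mapping the orthant onto itself sends each standard basis vector to a
positive multiple of a standard basis vector. -/
theorem exists_map_single_eq_smul_single {d : ℕ} {A : (Fin d → ℝ) →ₗ[ℝ] (Fin d → ℝ)}
    (hA : Function.Injective A) (hQ : A '' orthant d = orthant d) (i : Fin d) :
    ∃ j : Fin d, ∃ c : ℝ, 0 < c ∧ A (Pi.single i 1) = c • (Pi.single j 1 : Fin d → ℝ) := by
  have single_mem (k : Fin d) : (Pi.single k 1 : Fin d → ℝ) ∈ orthant d :=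
    fun l => (Pi.single_nonneg.2 zero_le_one : (0 : Fin d → ℝ) ≤ Pi.single k 1) l
  set v := A (Pi.single i 1) with hv
  have hv_mem : v ∈ orthant d := hQ.le (Set.mem_image_of_mem A (single_mem i))
  have hv_ne : v ≠ 0 := by
    rw [hv, Ne, map_eq_zero_iff A hA]
    simp
  obtain ⟨j, hj⟩ := Function.ne_iff.1 hv_ne
  have hj_pos : 0 < v j := lt_of_le_of_ne (hv_mem j) (Ne.symm hj)
  obtain ⟨p, hp_mem, hp⟩ : Pi.single j 1 ∈ A '' orthant d := hQ.ge (single_mem j)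
  have hw_mem : v - v j • Pi.single j 1 ∈ orthant d := by
    intro k
    by_cases hk : k = j
    · subst hk
      simp
    · simpa [hk] using hv_mem k
  obtain ⟨q, hq_mem, hq⟩ : v - v j • Pi.single j 1 ∈ A '' orthant d := hQ.ge hw_mem
  have hsum : v j • p + q = Pi.single i 1 := hA (by simp [hp, hq, ← hv])
  have hp_eq : p = p i • Pi.single i 1 := by
    ext k
    by_cases hk : k = i
    · subst hk
      simp
    · have hk_sum : v j * p k + q k = 0 := by simpa [hk] using congrFun hsum k
      have hpk : p k = 0 := by nlinarith [hp_mem k, hq_mem k, mul_nonneg hj_pos.le (hp_mem k)]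
      simp [hk, hpk]
  have hj_eq : (Pi.single j 1 : Fin d → ℝ) = p i • v := by
    rw [← hp, hv, ← map_smul, ← hp_eq]
  have hpi : p i ≠ 0 := by
    intro h
    simp [h] at hj_eq
  refine ⟨j, (p i)⁻¹, inv_pos.2 (lt_of_le_of_ne (hp_mem i) hpi.symm), ?_⟩
  rw [hj_eq, inv_smul_smul₀ hpi]

/-- An invertible linear map of `ℝᵈ` mapping the closed nonnegative orthant onto itself is a
permutation matrix times a positive diagonal matrix: `A e_i = λ_i e_{π(i)}` with `λ_i > 0`. -/
theorem orthant_automorphism_eq_perm_mul_diag (d : ℕ)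
    (A : (Fin d → ℝ) →ₗ[ℝ] (Fin d → ℝ)) (hA : Function.Bijective A)
    (hQ : A '' orthant d = orthant d) :
    ∃ π : Equiv.Perm (Fin d), ∃ lam : Fin d → ℝ, (∀ i, 0 < lam i) ∧
      ∀ i : Fin d, A (Pi.single i 1) = lam i • (Pi.single (π i) 1 : Fin d → ℝ) := by
  choose π lam hlam hπ using exists_map_single_eq_smul_single hA.injective hQ
  have hπ_inj : Function.Injective π := by
    intro i k hik
    have h : lam k • (Pi.single i 1 : Fin d → ℝ) = lam i • Pi.single k 1 :=
      hA.injective (by rw [map_smul, map_smul, hπ, hπ, hik, smul_comm])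
    by_contra hne
    have h_i := congrFun h i
    simp [hne, (hlam k).ne'] at h_i
  exact ⟨Equiv.ofBijective π (Finite.injective_iff_bijective.1 hπ_inj), lam, hlam, hπ⟩
end

section
/- Fix integers j ≥ 1 and l, m ≥ 0. Let U = {(y, x, ω) ∈ ℝʲ × ℝˡ × ℝᵐ : x_s > 0 for all s, and y_i > (Σ_s x_s) + 1 for all i}, and let Δ° = {θ ∈ ℝʲ : θ_i > 0 for all i, Σ_i θ_i = 1} be the open standard (j−1)-simplex. Then the map Φ(y, x, ω) = ( y / (Σ_i y_i), ((Σ_s x_s) + 1) / (min_i y_i), x, ω ) is a homeomorphism from U onto Δ° × (0,1) × (0,∞)ˡ × ℝᵐ, with inverse Ψ(θ, r, x, ω) = ( (((Σ_s x_s) + 1) / (r · min_i θ_i)) · θ, x, ω ). -/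
noncomputable section

/-- The set `U = {(y, x, ω) : x_s > 0 ∀s, y_i > (Σ_s x_s) + 1 ∀i} ⊆ ℝʲ × ℝˡ × ℝᵐ`. -/
def Uset (j l m : ℕ) : Set ((Fin j → ℝ) × (Fin l → ℝ) × (Fin m → ℝ)) :=
  {p | (∀ s, 0 < p.2.1 s) ∧ ∀ i, p.1 i > (∑ s, p.2.1 s) + 1}

/-- The target set `Δ° × (0,1) × (0,∞)ˡ × ℝᵐ`, where `Δ°` is the open standard
`(j−1)`-simplex. -/
def Tset (j l m : ℕ) : Set ((Fin j → ℝ) × ℝ × (Fin l → ℝ) × (Fin m → ℝ)) :=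
  {p | (∀ i, 0 < p.1 i) ∧ (∑ i, p.1 i) = 1 ∧ p.2.1 ∈ Set.Ioo (0 : ℝ) 1 ∧ ∀ s, 0 < p.2.2.1 s}

/-- The map `Φ(y, x, ω) = (y/Σy, ((Σx)+1)/min y, x, ω)`. -/
def PhiMap (j l m : ℕ) (p : (Fin j → ℝ) × (Fin l → ℝ) × (Fin m → ℝ)) :
    (Fin j → ℝ) × ℝ × (Fin l → ℝ) × (Fin m → ℝ) :=
  (fun i => p.1 i / ∑ i', p.1 i', (((∑ s, p.2.1 s) + 1) / ⨅ i, p.1 i), p.2.1, p.2.2)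

/-- The map `Ψ(θ, r, x, ω) = ((((Σx)+1)/(r·min θ)) · θ, x, ω)`. -/
def PsiMap (j l m : ℕ) (q : (Fin j → ℝ) × ℝ × (Fin l → ℝ) × (Fin m → ℝ)) :
    (Fin j → ℝ) × (Fin l → ℝ) × (Fin m → ℝ) :=
  (fun i => (((∑ s, q.2.2.1 s) + 1) / (q.2.1 * ⨅ i', q.1 i')) * q.1 i, q.2.2.1, q.2.2.2)

theorem continuous_ciInf_apply {ι : Type*} [Fintype ι] [Nonempty ι] :
    Continuous fun f : ι → ℝ => ⨅ i, f i := by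
  simp_rw [← Finset.inf'_univ_eq_ciInf]
  exact Continuous.finset_inf'_apply _ fun i _ => continuous_apply i

theorem lt_ciInf_of_forall_lt {ι : Type*} [Finite ι] [Nonempty ι] {f : ι → ℝ} {a : ℝ}
    (h : ∀ i, a < f i) : a < ⨅ i, f i := by
  obtain ⟨i, hi⟩ := exists_eq_ciInf_of_finite (f := f)
  exact hi ▸ h i

/-- `Φ` is a homeomorphism from `U` onto `Δ° × (0,1) × (0,∞)ˡ × ℝᵐ` with inverse `Ψ`:
both maps are continuous on the respective sets, map them into each other, and are mutually
inverse. -/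
theorem phi_homeomorphism (j l m : ℕ) (hj : 1 ≤ j) :
    Set.MapsTo (PhiMap j l m) (Uset j l m) (Tset j l m) ∧
    Set.MapsTo (PsiMap j l m) (Tset j l m) (Uset j l m) ∧
    ContinuousOn (PhiMap j l m) (Uset j l m) ∧
    ContinuousOn (PsiMap j l m) (Tset j l m) ∧
    (∀ p ∈ Uset j l m, PsiMap j l m (PhiMap j l m p) = p) ∧
    (∀ q ∈ Tset j l m, PhiMap j l m (PsiMap j l m q) = q) := by
  have : Nonempty (Fin j) := ⟨⟨0, hj⟩⟩
  have sum_pos {y : Fin j → ℝ} (hy : ∀ i, 0 < y i) : 0 < ∑ i, y i :=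
    Finset.sum_pos (fun i _ => hy i) Finset.univ_nonempty
  have add_one_pos {x : Fin l → ℝ} (hx : ∀ s, 0 < x s) : 0 < (∑ s, x s) + 1 :=
    add_pos_of_nonneg_of_pos (Finset.sum_nonneg fun s _ => (hx s).le) one_pos
  have U_pos {p} (hp : p ∈ Uset j l m) (i : Fin j) : 0 < p.1 i :=
    (add_one_pos hp.1).trans (hp.2 i)
  have U_lt {p} (hp : p ∈ Uset j l m) : (∑ s, p.2.1 s) + 1 < ⨅ i, p.1 i :=
    lt_ciInf_of_forall_lt hp.2
  have ciInf_pos {y : Fin j → ℝ} (hy : ∀ i, 0 < y i) : 0 < ⨅ i, y i :=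
    lt_ciInf_of_forall_lt hy
  refine ⟨fun p hp => ?_, fun q hq => ?_, ?_, ?_, fun p hp => ?_, fun q hq => ?_⟩
  · have hS := sum_pos (U_pos hp)
    have hI := ciInf_pos (U_pos hp)
    refine ⟨fun i => div_pos (U_pos hp i) hS, ?_, ⟨div_pos (add_one_pos hp.1) hI,
      (div_lt_one hI).2 (U_lt hp)⟩, hp.1⟩
    simp only [PhiMap]
    rw [← Finset.sum_div, div_self hS.ne']
  · obtain ⟨hθ, -, ⟨hr0, hr1⟩, hx⟩ := hq
    have hI := ciInf_pos hθ
    refine ⟨hx, fun i => ?_⟩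
    simp only [PsiMap]
    have hle : ⨅ i, q.1 i ≤ q.1 i := ciInf_le (Set.finite_range _).bddBelow i
    have hlt : q.2.1 * ⨅ i, q.1 i < q.1 i := (mul_lt_of_lt_one_left hI hr1).trans_le hle
    rw [gt_iff_lt, div_mul_eq_mul_div, lt_div_iff₀ (mul_pos hr0 hI)]
    exact mul_lt_mul_of_pos_left hlt (add_one_pos hx)
  · refine .prodMk (continuousOn_pi.2 fun i => .div (by fun_prop) (by fun_prop)
      fun p hp => (sum_pos (U_pos hp)).ne') (.prodMk (.div (by fun_prop)
      (continuous_ciInf_apply.comp continuous_fst).continuousOn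
      fun p hp => (ciInf_pos (U_pos hp)).ne') (by fun_prop))
  · refine .prodMk (continuousOn_pi.2 fun i => .mul (.div (by fun_prop) (.mul (by fun_prop)
      (continuous_ciInf_apply.comp continuous_fst).continuousOn)
      fun q hq => (mul_pos hq.2.2.1.1 (ciInf_pos hq.1)).ne') (by fun_prop)) (by fun_prop)
  · have hS := sum_pos (U_pos hp)
    have hI := ciInf_pos (U_pos hp)
    have hA := add_one_pos hp.1
    refine Prod.ext (funext fun i => ?_) rfl
    have hinf : ⨅ i, p.1 i / ∑ i', p.1 i' = (⨅ i, p.1 i) / ∑ i', p.1 i' := by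
      simp_rw [div_eq_mul_inv]
      exact (Real.iInf_mul_of_nonneg (inv_nonneg.2 hS.le) _).symm
    simp only [PsiMap, PhiMap]
    rw [hinf]
    field_simp
  · obtain ⟨hθ, hsum, ⟨hr0, hr1⟩, hx⟩ := hq
    have hI := ciInf_pos hθ
    have hA := add_one_pos hx
    have hc := div_pos hA (mul_pos hr0 hI)
    refine Prod.ext (funext fun i => ?_) (Prod.ext ?_ rfl)
    · simp only [PsiMap, PhiMap]
      rw [← Finset.mul_sum, hsum, mul_one, mul_div_cancel_left₀ _ hc.ne']
    · simp only [PsiMap, PhiMap]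
      rw [← Real.mul_iInf_of_nonneg hc.le]
      field_simp
end
end
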